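/- Let C be a small category, let D be a category admitting all small colimits, let f : C ⥤ D be a functor, and let f̂ : PSh(C) ⥤ D be the left Kan extension of f along the Yoneda embedding (equivalently, the small-colimit-preserving extension of f). Then f̂ is an equivalence of categories if and only if the following three conditions hold: (i) f is fully faithful; (ii) for every object c of C the functor Hom_D(f(c), −) : D ⥤ Type preserves all small colimits; (iii) f generates D under small colimits, i.e., the only full subcategory of D that is closed under isomorphisms, contains f(c) for every c, and is closed under small colimits (taken in D) is D itself. -/

import Mathlib

open CategoryTheory CategoryTheory.Limits

universe w v u
universe w' t
theorem coyo_surj {E : Type v} [Category.{w} E] {J : Type u} [Category.{w'} J] {K : J ⥤ E} {c : Cocone K}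
    (hc : IsColimit c) (X : E) [PreservesColimit K (coyoneda.obj (Opposite.op X))] (h : X ⟶ c.pt) :
    ∃ (j : J) (g : X ⟶ K.obj j), g ≫ c.ι.app j = h := by
  have h1 := isColimitOfPreserves (coyoneda.obj (Opposite.op X)) hc
  obtain ⟨j, g, hg⟩ := Types.jointly_surjective_of_isColimit h1 h
  exact ⟨j, g, hg⟩

theorem coyo_desc {E : Type v} [Category.{w} E] {J : Type u} [Category.{w'} J] {K : J ⥤ E} {c : Cocone K}
    (hc : IsColimit c) (X : E) [PreservesColimit K (coyoneda.obj (Opposite.op X))] {T : Type t}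
    (φ : ∀ j, (X ⟶ K.obj j) → T)
    (hφ : ∀ {j j'} (k : j ⟶ j') (g : X ⟶ K.obj j), φ j' (g ≫ K.map k) = φ j g) :
    ∃ Φ : (X ⟶ c.pt) → T, ∀ j g, Φ (g ≫ c.ι.app j) = φ j g := by
  have h1 := (Types.isColimit_iff_coconeTypesIsColimit _).1
    ⟨isColimitOfPreserves (coyoneda.obj (Opposite.op X)) hc⟩
  refine ⟨h1.desc { pt := T, ι := φ, ι_naturality := ?_ }, ?_⟩
  · intro j j' k; funext g; exact hφ k g
  · intro j g
    exact h1.fac_apply { pt := T, ι := φ, ι_naturality := _ } j g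

theorem psh_preserves {C : Type u} [SmallCategory C] (c : C) :
    PreservesColimitsOfSize.{u, u} (coyoneda.obj (Opposite.op (yoneda.obj c))) := by
  have e : (coyoneda.obj (Opposite.op (yoneda.obj c))) ≅ (evaluation Cᵒᵖ (Type u)).obj (Opposite.op c) :=
    NatIso.ofComponents (fun P => yonedaEquiv.toIso) (fun {P Q} g => by
      ext p
      exact yonedaEquiv_comp p g)
  exact preservesColimits_of_natIso e.symm

theorem size_transfer {D : Type v} [Category.{w} D] (G : D ⥤ Type w) (G' : D ⥤ Type u)
    [PreservesColimitsOfSize.{u, u} G'] (e : ∀ d, G.obj d ≃ G'.obj d)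
    (he : ∀ {d d'} (k : d ⟶ d') (x : G.obj d), e d' (G.map k x) = G'.map k (e d x)) :
    PreservesColimitsOfSize.{u, u} G := by
  have i : G' ⋙ uliftFunctor.{w} ≅ G ⋙ uliftFunctor.{u} :=
    (NatIso.ofComponents (fun d => (Equiv.ulift.trans ((e d).trans Equiv.ulift.symm)).toIso) (by
      intro d d' k
      ext ⟨x⟩
      exact congrArg ULift.up (he k x))).symm
  have : PreservesColimitsOfSize.{u, u} (G ⋙ uliftFunctor.{u}) := preservesColimits_of_natIso i
  exact preservesColimits_of_reflects_of_preserves G uliftFunctor.{u}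

section
variable {C : Type u} [SmallCategory C]
    {D : Type v} [Category.{w} D] [HasColimitsOfSize.{u, u} D]
    (f : C ⥤ D) (F : (Cᵒᵖ ⥤ Type u) ⥤ D) (α : f ⟶ yoneda ⋙ F)
    [F.IsLeftKanExtension α]

set_option linter.unusedSectionVars false

noncomputable def ptw : (Functor.LeftExtension.mk _ α).IsPointwiseLeftKanExtension :=
  Functor.isPointwiseLeftKanExtensionOfIsLeftKanExtension F α

theorem α_iso : IsIso α := (ptw f F α).isIso_hom

theorem kan_hom_ext {P : Cᵒᵖ ⥤ Type u} {d : D} {g h : F.obj P ⟶ d}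
    (H : ∀ (c : C) (p : yoneda.obj c ⟶ P), α.app c ≫ F.map p ≫ g = α.app c ≫ F.map p ≫ h) : g = h := by
  refine (ptw f F α P).hom_ext fun j => ?_
  change (α.app j.left ≫ F.map j.hom) ≫ g = (α.app j.left ≫ F.map j.hom) ≫ h
  simpa using H j.left j.hom

theorem kan_desc {P : Cᵒᵖ ⥤ Type u} {d : D} (φ : ∀ c : C, (yoneda.obj c ⟶ P) → (f.obj c ⟶ d))
    (hφ : ∀ {c c' : C} (k : c ⟶ c') (p : yoneda.obj c' ⟶ P), φ c (yoneda.map k ≫ p) = f.map k ≫ φ c' p) :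
    ∃ g : F.obj P ⟶ d, ∀ c p, α.app c ≫ F.map p ≫ g = φ c p := by
  let s : Cocone (CostructuredArrow.proj yoneda P ⋙ f) :=
    { pt := d
      ι := { app := fun j => φ j.left j.hom
             naturality := by
              intro j j' k
              have := hφ k.left j'.hom
              rw [CostructuredArrow.w] at this
              exact this.symm.trans (Category.comp_id _).symm } }
  refine ⟨(ptw f F α P).desc s, fun c p => ?_⟩
  have := (ptw f F α P).fac s (CostructuredArrow.mk p)
  exact (Category.assoc _ _ _).symm.trans this

theorem unit_nat {P : Cᵒᵖ ⥤ Type u} {c c' : C} (k : c ⟶ c') (p : yoneda.obj c' ⟶ P) :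
    α.app c ≫ F.map (yoneda.map k ≫ p) = f.map k ≫ α.app c' ≫ F.map p := by
  have := α.naturality k
  simp only [Functor.comp_map] at this
  rw [F.map_comp, ← Category.assoc, ← this, Category.assoc]

theorem unit_bij [f.Full] [f.Faithful]
    (h2 : ∀ c : C, PreservesColimitsOfSize.{u, u} (coyoneda.obj (Opposite.op (f.obj c))))
    (P : Cᵒᵖ ⥤ Type u) (c : C) :
    Function.Bijective (fun p : yoneda.obj c ⟶ P => α.app c ≫ F.map p) := by
  have := h2 c
  constructor
  · obtain ⟨Φ, hΦ⟩ := coyo_desc (ptw f F α P) (f.obj c) (T := yoneda.obj c ⟶ P)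
      (fun j g => yoneda.map (f.preimage (Y := j.left) g) ≫ j.hom) (by
        intro j j' k g
        change f.obj c ⟶ f.obj j.left at g
        change yoneda.map (f.preimage (g ≫ f.map k.left)) ≫ j'.hom = yoneda.map (f.preimage g) ≫ j.hom
        have : f.preimage (g ≫ f.map k.left) = f.preimage g ≫ k.left :=
          f.map_injective (by simp)
        rw [this, Functor.map_comp, Category.assoc, CostructuredArrow.w])
    have key : ∀ p : yoneda.obj c ⟶ P, Φ (α.app c ≫ F.map p) = p := by
      intro p
      have := hΦ (CostructuredArrow.mk p) (𝟙 _)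
      have e : f.preimage (𝟙 (f.obj c)) = 𝟙 c := f.map_injective (by simp)
      have h3 := this.trans (congrArg (fun z => yoneda.map z ≫ p) e)
      change Φ (𝟙 (f.obj c) ≫ α.app c ≫ F.map p) = yoneda.map (𝟙 c) ≫ p at h3
      rw [Category.id_comp] at h3
      refine h3.trans ?_
      rw [CategoryTheory.Functor.map_id, Category.id_comp]
    intro p q h
    rw [← key p, ← key q]
    exact congrArg Φ h
  · intro h
    obtain ⟨j, g, hg⟩ := coyo_surj (ptw f F α P) (f.obj c) h
    change f.obj c ⟶ f.obj j.left at g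
    change g ≫ α.app j.left ≫ F.map j.hom = h at hg
    refine ⟨yoneda.map (f.preimage g) ≫ j.hom, ?_⟩
    dsimp only
    rw [unit_nat, ← hg, f.map_preimage g]

end

theorem F_ff {C : Type u} [SmallCategory C]
    {D : Type v} [Category.{w} D] [HasColimitsOfSize.{u, u} D]
    (f : C ⥤ D) (F : (Cᵒᵖ ⥤ Type u) ⥤ D) (α : f ⟶ yoneda ⋙ F)
    [F.IsLeftKanExtension α] [f.Full] [f.Faithful]
    (h2 : ∀ c : C, PreservesColimitsOfSize.{u, u} (coyoneda.obj (Opposite.op (f.obj c)))) :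
    F.Full ∧ F.Faithful := by
  have hb := unit_bij f F α h2
  have yext : ∀ {P Q : Cᵒᵖ ⥤ Type u} {a b : P ⟶ Q}, (∀ (c : C) (p : yoneda.obj c ⟶ P), p ≫ a = p ≫ b) → a = b := by
    intro P Q a b h
    ext ⟨c⟩ x
    have := congrArg yonedaEquiv (h c (yonedaEquiv.symm x))
    simpa [yonedaEquiv_comp] using this
  refine ⟨⟨fun {P Q} g => ?_⟩, ⟨fun {P Q} a b h => ?_⟩⟩
  · choose q hq using fun (c : C) (p : yoneda.obj c ⟶ P) => (hb Q c).2 (α.app c ≫ F.map p ≫ g)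
    dsimp only at hq
    have qn : ∀ {c c' : C} (k : c ⟶ c') (p : yoneda.obj c' ⟶ P),
        q c (yoneda.map k ≫ p) = yoneda.map k ≫ q c' p := by
      intro c c' k p
      apply (hb Q c).1
      dsimp only
      rw [unit_nat, hq, hq, ← Category.assoc, unit_nat]
      simp
    let a : P ⟶ Q :=
      { app := fun c => TypeCat.ofHom fun x => yonedaEquiv (q c.unop (yonedaEquiv.symm x))
        naturality := by
          intro c c' k
          ext x
          have := qn k.unop (yonedaEquiv.symm x)
          have e : yonedaEquiv.symm (P.map k x) = yoneda.map k.unop ≫ yonedaEquiv.symm x :=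
            yonedaEquiv_symm_map k x
          simp [e, this]
          exact (yonedaEquiv_naturality' _ k).symm }
    have ha : ∀ (c : C) (p : yoneda.obj c ⟶ P), p ≫ a = q c p := by
      intro c p
      apply yonedaEquiv.injective
      rw [yonedaEquiv_comp]
      simp [a]
    refine ⟨a, kan_hom_ext f F α fun c p => ?_⟩
    rw [← F.map_comp, ha, hq]
  · refine yext fun c p => (hb Q c).1 ?_
    simp [h]

theorem F_pres {C : Type u} [SmallCategory C]
    {D : Type v} [Category.{w} D] [HasColimitsOfSize.{u, u} D]
    (f : C ⥤ D) (F : (Cᵒᵖ ⥤ Type u) ⥤ D) (α : f ⟶ yoneda ⋙ F)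
    [F.IsLeftKanExtension α] : PreservesColimitsOfSize.{u, u} F := by
  refine ⟨fun {J _} => ⟨fun {K} => ⟨fun {t} ht => ?_⟩⟩⟩
  have hp := fun c : C => psh_preserves c
  have ex : ∀ s : Cocone (K ⋙ F), ∃ g : F.obj t.pt ⟶ s.pt, ∀ j, F.map (t.ι.app j) ≫ g = s.ι.app j := by
    intro s
    choose Φ hΦ using fun c : C => coyo_desc ht (yoneda.obj c) (T := f.obj c ⟶ s.pt)
      (fun j p => α.app c ≫ F.map p ≫ s.ι.app j) (by
        intro j j' k p
        have := s.w k
        dsimp at this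
        simp [this])
    obtain ⟨g, hg⟩ := kan_desc f F α Φ (by
      intro c c' k p
      obtain ⟨j, p, rfl⟩ := coyo_surj ht _ p
      rw [hΦ, ← Category.assoc (yoneda.map k), hΦ, ← Category.assoc, unit_nat]
      simp)
    refine ⟨g, fun j => kan_hom_ext f F α fun c p => ?_⟩
    rw [← hΦ, ← hg]
    simp
  choose g hg using ex
  refine ⟨{ desc := g, fac := hg, uniq := ?_ }⟩
  intro s m hm
  refine kan_hom_ext f F α fun c p => ?_
  obtain ⟨j, p, rfl⟩ := coyo_surj ht _ p
  have := hm j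
  dsimp at this
  simp [this, hg]

theorem leftKanExtension_isEquivalence_iff {C : Type u} [SmallCategory C]
    {D : Type v} [Category.{w} D] [HasColimitsOfSize.{u, u} D]
    (f : C ⥤ D) (F : (Cᵒᵖ ⥤ Type u) ⥤ D) (α : f ⟶ yoneda ⋙ F)
    [F.IsLeftKanExtension α] :
    F.IsEquivalence ↔
      (f.Full ∧ f.Faithful) ∧
      (∀ c : C, PreservesColimitsOfSize.{u, u} (coyoneda.obj (Opposite.op (f.obj c)))) ∧
      (∀ S : Set D,
        (∀ {X Y : D}, (X ≅ Y) → X ∈ S → Y ∈ S) →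
        (∀ c : C, f.obj c ∈ S) →
        (∀ (J : Type u) [SmallCategory J] (G : J ⥤ D), (∀ j, G.obj j ∈ S) → colimit G ∈ S) →
        ∀ d : D, d ∈ S) := by
  constructor
  · intro hF
    have := α_iso f F α
    refine ⟨⟨Functor.Full.of_iso (asIso α).symm, Functor.Faithful.of_iso (asIso α).symm⟩, ?_, ?_⟩
    · intro c
      have := psh_preserves c
      have i : F.obj (yoneda.obj c) ≅ f.obj c := ((asIso α).app c).symm
      refine size_transfer _ (F.inv ⋙ coyoneda.obj (Opposite.op (yoneda.obj c)))
        (fun d => (i.homCongr (Iso.refl d)).symm.trans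
          (F.asEquivalence.toAdjunction.homEquiv (yoneda.obj c) d)) ?_
      intro d d' k x
      have := F.asEquivalence.toAdjunction.homEquiv_naturality_right (i.hom ≫ x) k
      have e1 : (i.homCongr (Iso.refl d)).symm x = i.hom ≫ x := by simp
      have e2 : (i.homCongr (Iso.refl d')).symm (x ≫ k) = (i.hom ≫ x) ≫ k := by simp
      change F.asEquivalence.toAdjunction.homEquiv _ _ ((i.homCongr (Iso.refl d')).symm (x ≫ k)) =
        F.asEquivalence.toAdjunction.homEquiv _ _ ((i.homCongr (Iso.refl d)).symm x) ≫ _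
      rw [e1, e2]
      exact this
    · intro S hS hf hc d
      refine hS (F.objObjPreimageIso d) ?_
      refine hS ((colimit.isColimit _).coconePointUniqueUpToIso (ptw f F α (F.objPreimage d))) ?_
      exact hc _ _ fun j => hf j.left
  · rintro ⟨⟨h1, h1'⟩, h2, h3⟩
    have := α_iso f F α
    have := F_pres f F α
    obtain ⟨_, _⟩ := F_ff f F α h2
    have : F.EssSurj := ⟨h3 {d | F.essImage d}
      (fun e h => Functor.essImage.ofIso e h)
      (fun c => ⟨_, ⟨((asIso α).app c).symm⟩⟩)
      (fun J _ G hG => ⟨colimit (Functor.essImage.liftFunctor G F hG),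
        ⟨preservesColimitIso F _ ≪≫ HasColimit.isoOfNatIso (Functor.essImage.liftFunctorCompIso G F hG)⟩⟩)⟩
    exact { }
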